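/- Let (Ω, p) be a finite probability space and let A_1(ω), ..., A_m(ω) be independent random matrices in M_d(ℂ) that are positive semidefinite Hermitian of rank one for every ω ∈ Ω, and let A = A_1 + ... + A_m. Then for every j = 1, ..., d: min_{ω∈Ω} ρ_j(p_{A(ω)}) ≤ ρ_j(μ[E(A_1), ..., E(A_m)]) ≤ max_{ω∈Ω} ρ_j(p_{A(ω)}), where the minimum and maximum are over ω of positive probability. -/

import Mathlib

open MvPolynomial
open scoped Classical ComplexOrder

/-- The *mixed characteristic polynomial*
`μ[A₁,…,A_m](z) = ∏_{i=1}^m (1 - ∂_i) det (z I_d + ∑ i, z_i A_i) |_{z₁ = ⋯ = z_m = 0}`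
of the matrices `A₁, …, A_m ∈ M_d(ℂ)`, as a one-variable polynomial over `ℂ`.
We work in `m + 1` variables, variable `0` playing the role of `z` and variable
`i.succ` the role of `z_i`. -/
noncomputable def mixedCharPoly {d m : ℕ} (A : Fin m → Matrix (Fin d) (Fin d) ℂ) :
    Polynomial ℂ :=
  MvPolynomial.eval₂ Polynomial.C
    (Fin.cases Polynomial.X (fun _ : Fin m => 0))
    ((List.finRange m).foldr (fun i q => q - MvPolynomial.pderiv i.succ q)
      (Matrix.det
        ((MvPolynomial.X (0 : Fin (m + 1)) : MvPolynomial (Fin (m + 1)) ℂ) •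
            (1 : Matrix (Fin d) (Fin d) (MvPolynomial (Fin (m + 1)) ℂ)) +
          ∑ i : Fin m,
            (MvPolynomial.X i.succ : MvPolynomial (Fin (m + 1)) ℂ) •
              (A i).map MvPolynomial.C)))

/-- A finite family of random matrices on a finite probability space `(Ω, pr)` is
*independent* if the joint distribution of the family is the product of the marginal
distributions. -/
def IndepMatrices {d m : ℕ} {Ω : Type*} [Fintype Ω] (pr : Ω → ℝ)
    (A : Fin m → Ω → Matrix (Fin d) (Fin d) ℂ) : Prop :=
  ∀ B : Fin m → Matrix (Fin d) (Fin d) ℂ,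
    (∑ ω, if ∀ i, A i ω = B i then pr ω else 0)
      = ∏ i, ∑ ω, if A i ω = B i then pr ω else 0

/-- The `j`-th largest root of a complex polynomial with real roots, indexed from
`j = 1`: the `j`-th largest element of the multiset of real parts of the roots
(counted with multiplicity); defaults to `0` if there are fewer than `j` roots. -/
noncomputable def rhoC (f : Polynomial ℂ) (j : ℕ) : ℝ :=
  (((f.roots.map Complex.re).sort (· ≤ ·)).reverse).getD (j - 1) 0

/-- A monic complex polynomial of degree `d` all of whose roots are real. -/
def MonicRealRooted (d : ℕ) (f : Polynomial ℂ) : Prop :=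
  f.Monic ∧ f.natDegree = d ∧ ∀ z : ℂ, f.eval z = 0 → z.im = 0

lemma rhoC_prod_X_sub_C {d : ℕ} {r : Fin d → ℝ} (hr : Antitone r) (k : Fin d) :
    rhoC (∏ i, (Polynomial.X - Polynomial.C (r i : ℂ))) (k + 1) = r k := by
  have hroots : (∏ i, (Polynomial.X - Polynomial.C (r i : ℂ))).roots.map Complex.re
      = (List.ofFn r : Multiset ℝ) := by
    rw [Polynomial.roots_prod _ _ (
      Finset.prod_ne_zero_iff.2 fun i _ => Polynomial.X_sub_C_ne_zero _)]
    simp [Multiset.bind_singleton, Function.comp_def, Fin.univ_val_map]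
  have hlist : (((List.ofFn r : Multiset ℝ)).sort (· ≤ ·)).reverse = List.ofFn r := by
    refine List.Perm.eq_of_sortedGE ?_ (List.sortedGE_ofFn_iff.2 hr) ?_
    · exact (Multiset.pairwise_sort _ _).sortedLE.reverse
    · exact (List.reverse_perm _).trans (Multiset.coe_eq_coe.1 (Multiset.sort_eq _ _))
  rw [rhoC, hroots, hlist]
  simp [List.getD]

lemma MonicRealRooted.exists_antitone {d : ℕ} {f : Polynomial ℂ} (hf : MonicRealRooted d f) :
    ∃ r : Fin d → ℝ, Antitone r ∧ f = ∏ i, (Polynomial.X - Polynomial.C (r i : ℂ)) := by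
  obtain ⟨hmonic, hdeg, hreal⟩ := hf
  set l := ((f.roots.map Complex.re).sort (· ≤ ·)).reverse with hl
  have hlm : (l : Multiset ℝ) = f.roots.map Complex.re := by
    rw [hl, Multiset.coe_reverse, Multiset.sort_eq]
  have hlen : l.length = d := by
    rw [← Multiset.coe_card, hlm, Multiset.card_map, ← hdeg]
    exact (IsAlgClosed.splits f).natDegree_eq_card_roots.symm
  have hsorted : l.SortedGE := (Multiset.pairwise_sort _ _).sortedLE.reverse
  subst hlen
  refine ⟨l.get, hsorted.antitone_get, ?_⟩
  have hprod : (f.roots.map fun z => Polynomial.X - Polynomial.C z).prod = f :=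
    ((IsAlgClosed.splits f).eq_prod_roots_of_monic hmonic).symm
  have hre : f.roots = (l : Multiset ℝ).map (fun x : ℝ => (x : ℂ)) := by
    rw [hlm, Multiset.map_map]
    conv_lhs => rw [← Multiset.map_id f.roots]
    refine Multiset.map_congr rfl fun z hz => ?_
    have := hreal z (Polynomial.isRoot_of_mem_roots hz)
    exact Complex.ext (by simp) (by simp [this])
  rw [← hprod, hre, Multiset.map_map, Multiset.map_coe, Multiset.prod_coe, ← List.prod_ofFn]
  congr 1
  conv_lhs => rw [← List.ofFn_get l]
  rw [List.map_ofFn]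
  rfl

lemma MonicRealRooted.antitone_rhoC {d : ℕ} {f : Polynomial ℂ} (hf : MonicRealRooted d f) :
    Antitone fun k : Fin d => rhoC f (k + 1) := by
  obtain ⟨r, hr, rfl⟩ := hf.exists_antitone
  simpa only [rhoC_prod_X_sub_C hr] using hr

lemma MonicRealRooted.eq_prod {d : ℕ} {f : Polynomial ℂ} (hf : MonicRealRooted d f) :
    f = ∏ k : Fin d, (Polynomial.X - Polynomial.C (rhoC f (k + 1) : ℂ)) := by
  obtain ⟨r, hr, rfl⟩ := hf.exists_antitone
  simp only [rhoC_prod_X_sub_C hr]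

lemma MonicRealRooted.eval_rhoC {d : ℕ} {f : Polynomial ℂ} (hf : MonicRealRooted d f)
    (k : Fin d) : f.eval (rhoC f (k + 1) : ℂ) = 0 := by
  obtain ⟨r, hr, rfl⟩ := hf.exists_antitone
  rw [rhoC_prod_X_sub_C hr, Polynomial.eval_prod]
  exact Finset.prod_eq_zero (Finset.mem_univ k) (by simp)

/-- The segment of polynomials from `f` to `g`. -/
noncomputable def polySegment (f g : Polynomial ℂ) (t : ℝ) : Polynomial ℂ :=
  Polynomial.C ((1 - t : ℝ) : ℂ) * f + Polynomial.C (t : ℂ) * g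

lemma cauchyBound_polySegment_le {d : ℕ} {f g : Polynomial ℂ} {t : ℝ} (ht : t ∈ Set.Icc (0 : ℝ) 1)
    (hf : MonicRealRooted d f) (hg : MonicRealRooted d g)
    (h : MonicRealRooted d (polySegment f g t)) :
    (polySegment f g t).cauchyBound ≤ f.cauchyBound + g.cauchyBound := by
  have hle : ∀ i, ‖(polySegment f g t).coeff i‖₊ ≤ ‖f.coeff i‖₊ + ‖g.coeff i‖₊ := by
    intro i
    rw [← NNReal.coe_le_coe]
    push_cast
    have h1 : |1 - t| ≤ 1 := by rw [abs_le]; constructor <;> linarith [ht.1, ht.2]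
    have h2 : |t| ≤ 1 := by rw [abs_le]; constructor <;> linarith [ht.1, ht.2]
    calc ‖(polySegment f g t).coeff i‖
        ≤ ‖((1 - t : ℝ) : ℂ) * f.coeff i‖ + ‖(t : ℂ) * g.coeff i‖ := by
          rw [polySegment, Polynomial.coeff_add, Polynomial.coeff_C_mul, Polynomial.coeff_C_mul]
          exact norm_add_le _ _
      _ ≤ ‖f.coeff i‖ + ‖g.coeff i‖ := by
          rw [norm_mul, norm_mul, Complex.norm_real, Complex.norm_real]
          exact add_le_add (mul_le_of_le_one_left (norm_nonneg _) h1)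
            (mul_le_of_le_one_left (norm_nonneg _) h2)
  have hsup : (Finset.range d).sup (fun i => ‖(polySegment f g t).coeff i‖₊) ≤
      (Finset.range d).sup (fun i => ‖f.coeff i‖₊) +
        (Finset.range d).sup (fun i => ‖g.coeff i‖₊) :=
    Finset.sup_le fun i hi => (hle i).trans (add_le_add
      (Finset.le_sup (f := fun i => ‖f.coeff i‖₊) hi)
      (Finset.le_sup (f := fun i => ‖g.coeff i‖₊) hi))
  simp only [Polynomial.cauchyBound, h.1.leadingCoeff, hf.1.leadingCoeff, hg.1.leadingCoeff,
    h.2.1, hf.2.1, hg.2.1, nnnorm_one, div_one]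
  calc _ ≤ _ := add_le_add_left hsup 1
    _ ≤ _ := by rw [add_add_add_comm, ← add_assoc]; exact le_self_add

lemma continuousOn_rhoC_polySegment {d : ℕ} {f g : Polynomial ℂ}
    (h : ∀ t ∈ Set.Icc (0 : ℝ) 1, MonicRealRooted d (polySegment f g t)) :
    ContinuousOn (fun t (k : Fin d) => rhoC (polySegment f g t) (k + 1)) (Set.Icc 0 1) := by
  have hf : MonicRealRooted d f := by simpa [polySegment] using h 0 (by simp)
  have hg : MonicRealRooted d g := by simpa [polySegment] using h 1 (by simp)
  intro t ht
  set R : ℝ := ((f.cauchyBound + g.cauchyBound : NNReal) : ℝ)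
  refine (isCompact_univ_pi fun _ : Fin d => isCompact_Icc (a := -R) (b := R)
    ).tendsto_nhds_of_unique_mapClusterPt ?_ ?_
  · filter_upwards [self_mem_nhdsWithin] with s hs k _
    have hlt := (Polynomial.IsRoot.norm_lt_cauchyBound (h s hs).1.ne_zero
      ((h s hs).eval_rhoC k)).trans_le (cauchyBound_polySegment_le hs hf hg (h s hs))
    have hlt' : |rhoC (polySegment f g s) (k + 1)| < R := by
      rw [← NNReal.coe_lt_coe, coe_nnnorm, Complex.norm_real] at hlt
      exact hlt
    exact ⟨(abs_lt.1 hlt').1.le, (abs_lt.1 hlt').2.le⟩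
  · intro r _ hr
    obtain ⟨U, hU, hUr⟩ := mapClusterPt_iff_ultrafilter.1 hr
    have hmem : ∀ᶠ s in (U : Filter ℝ), s ∈ Set.Icc (0 : ℝ) 1 := hU self_mem_nhdsWithin
    have hid : Filter.Tendsto (fun s : ℝ => s) U (nhds t) :=
      Filter.tendsto_id'.2 (hU.trans nhdsWithin_le_nhds)
    have hk := tendsto_pi_nhds.1 hUr
    have hanti : Antitone r := fun a b hab =>
      le_of_tendsto_of_tendsto (hk b) (hk a) (hmem.mono fun s hs => (h s hs).antitone_rhoC hab)
    have heq : polySegment f g t = ∏ i, (Polynomial.X - Polynomial.C (r i : ℂ)) := by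
      refine Polynomial.funext fun z => ?_
      have h1 : Filter.Tendsto (fun s => (polySegment f g s).eval z) U
          (nhds ((polySegment f g t).eval z)) := by
        have hc : Continuous fun s => (polySegment f g s).eval z := by
          simp only [polySegment, Polynomial.eval_add, Polynomial.eval_mul, Polynomial.eval_C]
          fun_prop
        exact (hc.tendsto t).comp hid
      have h2 : Filter.Tendsto (fun s => ∏ k : Fin d,
          (z - (rhoC (polySegment f g s) (k + 1) : ℂ))) U (nhds (∏ k, (z - (r k : ℂ)))) :=
        tendsto_finsetProd _ fun k _ => tendsto_const_nhds.sub
          ((Complex.continuous_ofReal.tendsto _).comp (hk k))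
      have h3 : (fun s => (polySegment f g s).eval z) =ᶠ[(U : Filter ℝ)] fun s => ∏ k : Fin d,
          (z - (rhoC (polySegment f g s) (k + 1) : ℂ)) := by
        filter_upwards [hmem] with s hs
        conv_lhs => rw [(h s hs).eq_prod]
        simp [Polynomial.eval_prod]
      rw [tendsto_nhds_unique h1 (h2.congr' h3.symm)]
      simp [Polynomial.eval_prod]
    funext k
    simp only [heq, rhoC_prod_X_sub_C hanti]

/-- A continuous function on `[0, 1]` attaining all but finitely many values at most once is
bounded by the larger of its endpoint values. -/
lemma le_max_of_continuousOn_of_finite {lam : ℝ → ℝ} (hc : ContinuousOn lam (Set.Icc 0 1))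
    {Z : Set ℝ} (hZ : Z.Finite)
    (hinj : ∀ s ∈ Set.Icc (0 : ℝ) 1, ∀ s' ∈ Set.Icc (0 : ℝ) 1, s ≠ s' → lam s = lam s' → lam s ∈ Z)
    {t : ℝ} (ht : t ∈ Set.Icc (0 : ℝ) 1) : lam t ≤ max (lam 0) (lam 1) := by
  by_contra! hlt
  refine (Set.Ioo_infinite hlt) (hZ.subset ?_)
  rintro x ⟨hx1, hx2⟩
  obtain ⟨s, hs, hsx⟩ := intermediate_value_Ioo ht.1
    (hc.mono (Set.Icc_subset_Icc le_rfl ht.2)) ⟨(le_max_left _ _).trans_lt hx1, hx2⟩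
  obtain ⟨s', hs', hsx'⟩ := intermediate_value_Ioo' ht.2
    (hc.mono (Set.Icc_subset_Icc ht.1 le_rfl)) ⟨(le_max_right _ _).trans_lt hx1, hx2⟩
  rw [← hsx]
  exact hinj s ⟨hs.1.le, hs.2.le.trans ht.2⟩ s' ⟨ht.1.trans hs'.1.le, hs'.2.le⟩
    (hs.2.trans hs'.1).ne (hsx.trans hsx'.symm)

/-- If all polynomials on the segment from `f` to `g` are monic and real-rooted, their `k`-th
largest roots lie between those of `f` and `g`. -/
lemma rhoC_polySegment_between {d : ℕ} {f g : Polynomial ℂ}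
    (h : ∀ t ∈ Set.Icc (0 : ℝ) 1, MonicRealRooted d (polySegment f g t)) (k : Fin d)
    {t : ℝ} (ht : t ∈ Set.Icc (0 : ℝ) 1) :
    min (rhoC f (k + 1)) (rhoC g (k + 1)) ≤ rhoC (polySegment f g t) (k + 1) ∧
      rhoC (polySegment f g t) (k + 1) ≤ max (rhoC f (k + 1)) (rhoC g (k + 1)) := by
  have h0 : polySegment f g 0 = f := by simp [polySegment]
  have h1 : polySegment f g 1 = g := by simp [polySegment]
  have hf : f ≠ 0 := h0 ▸ (h 0 (by simp)).1.ne_zero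
  have hc : ContinuousOn (fun t => rhoC (polySegment f g t) (k + 1)) (Set.Icc 0 1) :=
    continuousOn_pi.1 (continuousOn_rhoC_polySegment h) k
  have hinj : ∀ s ∈ Set.Icc (0 : ℝ) 1, ∀ s' ∈ Set.Icc (0 : ℝ) 1, s ≠ s' →
      rhoC (polySegment f g s) (k + 1) = rhoC (polySegment f g s') (k + 1) →
      f.eval (rhoC (polySegment f g s) (k + 1) : ℂ) = 0 := by
    intro s hs s' hs' hne heq
    have e1 := (h s hs).eval_rhoC k
    have e2 := (h s' hs').eval_rhoC k
    rw [← heq] at e2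
    set x : ℂ := (rhoC (polySegment f g s) (k + 1) : ℂ)
    simp only [polySegment, Polynomial.eval_add, Polynomial.eval_mul, Polynomial.eval_C] at e1 e2
    have hne' : (s' : ℂ) - s ≠ 0 := sub_ne_zero.2 fun hh => hne (by exact_mod_cast hh.symm)
    refine (mul_eq_zero.1 (?_ : ((s' : ℂ) - s) * f.eval x = 0)).resolve_left hne'
    push_cast at e1 e2
    linear_combination (s' : ℂ) * e1 - (s : ℂ) * e2
  have hZ : {x : ℝ | f.eval (x : ℂ) = 0}.Finite :=
    (Polynomial.finite_setOfPred_isRoot hf).preimage Complex.ofReal_injective.injOn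
  have hup := le_max_of_continuousOn_of_finite hc hZ hinj ht
  have hlow := le_max_of_continuousOn_of_finite hc.neg (Z := {x : ℝ | f.eval ((-x : ℝ) : ℂ) = 0})
    (hZ.preimage neg_injective.injOn)
    (fun s hs s' hs' hne heq => by simpa using hinj s hs s' hs' hne (neg_injective heq)) ht
  simp only [Pi.neg_apply, h0, h1] at hup hlow
  refine ⟨?_, hup⟩
  rw [max_neg_neg] at hlow
  exact neg_le_neg_iff.1 hlow

section DeterminantExpansion

variable {n R : Type*} [Fintype n] [DecidableEq n] [CommRing R]

lemma det_add_smul_expand (M B : Matrix n n R) (w : R) :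
    (M + w • B).det = M.det + w * ∑ k, (M.updateRow k (B k)).det +
      ∑ s : Finset n with 2 ≤ s.card, w ^ s.card * Matrix.det (s.piecewise B M) := by
  have h := (Matrix.detRowAlternating (n := n) (R := R)).toMultilinearMap
    |>.map_add_eq_map_add_linearDeriv_add M (w • B)
  have hlin : (Matrix.detRowAlternating (n := n) (R := R)).toMultilinearMap.linearDeriv M (w • B)
      = w * ∑ k, (M.updateRow k (B k)).det := by
    refine (LinearMap.map_smul _ w (B : n → n → R)).trans (congrArg (w * ·) ?_)
    exact MultilinearMap.linearDeriv_apply _ _ _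
  rw [hlin] at h
  refine Eq.trans h (congrArg₂ _ rfl (Finset.sum_congr rfl fun s _ => ?_))
  have hs := (Matrix.detRowAlternating (n := n) (R := R)).toMultilinearMap.map_piecewise_smul
    (fun _ => w) (s.piecewise B M) s
  rw [Finset.prod_const, smul_eq_mul] at hs
  refine Eq.trans (congrArg _ ?_) hs
  funext k
  by_cases hk : k ∈ s
  · simp only [Finset.piecewise, hk, if_true]
    rfl
  · simp only [Finset.piecewise, hk, if_false]

lemma sq_dvd_det_add_smul_sub (M B : Matrix n n R) (w : R) :
    w ^ 2 ∣ (M + w • B).det - (M.det + w * ∑ k, (M.updateRow k (B k)).det) := by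
  rw [det_add_smul_expand, add_sub_cancel_left]
  exact Finset.dvd_sum fun s hs =>
    Dvd.dvd.mul_right (pow_dvd_pow w (Finset.mem_filter.1 hs).2) _

lemma det_eq_zero_of_rows_eq_smul {M : Matrix n n R} {a b : n} (hab : a ≠ b) {x y : R}
    {v : n → R} (ha : M a = x • v) (hb : M b = y • v) : M.det = 0 := by
  have h1 : (M.updateRow b v) = (M.updateRow b v).updateRow a (x • v) := by
    rw [← ha, ← Matrix.updateRow_ne (M := M) (b := v) hab, Matrix.updateRow_eq_self]
  have h2 : (M.updateRow b v).det = 0 := by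
    rw [h1, Matrix.det_updateRow_smul, Matrix.det_zero_of_row_eq hab, mul_zero]
    rw [Matrix.updateRow_self, Matrix.updateRow_ne hab.symm, Matrix.updateRow_self]
  rw [← Matrix.updateRow_eq_self M b, hb, Matrix.det_updateRow_smul, h2, mul_zero]

lemma det_add_smul_vecMulVec (M : Matrix n n R) (u v : n → R) (w : R) :
    (M + w • Matrix.vecMulVec u v).det =
      M.det + w * ∑ k, (M.updateRow k (Matrix.vecMulVec u v k)).det := by
  rw [det_add_smul_expand, add_eq_left]
  refine Finset.sum_eq_zero fun s hs => ?_
  obtain ⟨a, ha, b, hb, hab⟩ := Finset.one_lt_card.1 (Finset.mem_filter.1 hs).2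
  rw [mul_eq_zero_of_right]
  have hrow : ∀ k ∈ s, s.piecewise (Matrix.vecMulVec u v) M k = u k • v := fun k hk => by
    refine (Finset.piecewise_eq_of_mem _ _ _ hk).trans ?_
    ext j
    simp [Matrix.vecMulVec_apply]
  exact det_eq_zero_of_rows_eq_smul hab (hrow a ha) (hrow b hb)

end DeterminantExpansion

lemma exists_eq_vecMulVec_of_rank_eq_one {d : ℕ} {A : Matrix (Fin d) (Fin d) ℂ}
    (hA : A.rank = 1) : ∃ u v : Fin d → ℂ, A = Matrix.vecMulVec u v := by
  obtain ⟨u, -, hu⟩ := finrank_eq_one_iff'.1 hA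
  have hcol : ∀ j, ∃ c : ℂ, c • (u : Fin d → ℂ) = A.col j := fun j => by
    obtain ⟨c, hc⟩ := hu ⟨A.col j, ⟨Pi.single j 1, by simp⟩⟩
    exact ⟨c, congrArg Subtype.val hc⟩
  choose v hv using hcol
  refine ⟨u, v, ?_⟩
  ext i j
  have := congrFun (hv j) i
  simp only [Pi.smul_apply, smul_eq_mul, Matrix.col_apply] at this
  rw [Matrix.vecMulVec_apply, ← this, mul_comm]

section MixedCharacteristic

variable {d m : ℕ}

/-- The composition of the operators `1 - ∂_i` over the indices `i` in a list. -/
noncomputable def oneSubPderivs (l : List (Fin m)) :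
    MvPolynomial (Fin (m + 1)) ℂ →ₗ[ℂ] MvPolynomial (Fin (m + 1)) ℂ :=
  (l.map fun i => (1 : Module.End ℂ (MvPolynomial (Fin (m + 1)) ℂ)) -
    (pderiv i.succ).toLinearMap).prod

@[simp]
lemma oneSubPderivs_nil (q : MvPolynomial (Fin (m + 1)) ℂ) : oneSubPderivs [] q = q := rfl

@[simp]
lemma oneSubPderivs_cons (i : Fin m) (l : List (Fin m)) (q : MvPolynomial (Fin (m + 1)) ℂ) :
    oneSubPderivs (i :: l) q = oneSubPderivs l q - pderiv i.succ (oneSubPderivs l q) := by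
  simp [oneSubPderivs]

/-- The specialization `z₁ = ⋯ = z_m = 0`. -/
noncomputable def specializeZero (m : ℕ) : MvPolynomial (Fin (m + 1)) ℂ →ₐ[ℂ] Polynomial ℂ :=
  aeval (Fin.cases Polynomial.X fun _ => 0)

/-- The matrix `z I + ∑ i, (z_i - c_i) A_i`. -/
noncomputable def pencil (c : Fin m → ℂ) (A : Fin m → Matrix (Fin d) (Fin d) ℂ) :
    Matrix (Fin d) (Fin d) (MvPolynomial (Fin (m + 1)) ℂ) :=
  (X 0 : MvPolynomial (Fin (m + 1)) ℂ) • 1 + ∑ i, (X i.succ - C (c i)) • (A i).map C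

lemma mixedCharPoly_eq (A : Fin m → Matrix (Fin d) (Fin d) ℂ) :
    mixedCharPoly A = specializeZero m (oneSubPderivs (List.finRange m) (pencil 0 A).det) := by
  have hfold : ∀ (l : List (Fin m)) (q : MvPolynomial (Fin (m + 1)) ℂ),
      l.foldr (fun i q => q - pderiv i.succ q) q = oneSubPderivs l q := fun l q => by
    induction l with
    | nil => rfl
    | cons i l ih => rw [List.foldr_cons, ih, oneSubPderivs_cons]
  simp only [mixedCharPoly, hfold, pencil, Pi.zero_apply, map_zero, sub_zero]
  rfl

/-! ### Affinity in each matrix -/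

lemma dvd_sub_pderiv_of_ne {i j : Fin m} (hij : j ≠ i) {k : ℕ} {q : MvPolynomial (Fin (m + 1)) ℂ}
    (hq : X i.succ ^ k ∣ q) : X i.succ ^ k ∣ q - pderiv j.succ q := by
  obtain ⟨p, rfl⟩ := hq
  have h0 : pderiv j.succ ((X i.succ : MvPolynomial (Fin (m + 1)) ℂ) ^ k) = 0 := by
    rw [pderiv_pow, pderiv_X_of_ne (by simpa using hij.symm), mul_zero]
  rw [pderiv_mul, h0, zero_mul, zero_add]
  exact dvd_sub (dvd_mul_right _ _) (dvd_mul_right _ _)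

lemma dvd_oneSubPderivs_of_notMem {i : Fin m} {k : ℕ} {q : MvPolynomial (Fin (m + 1)) ℂ}
    (hq : X i.succ ^ k ∣ q) {l : List (Fin m)} (hl : i ∉ l) :
    X i.succ ^ k ∣ oneSubPderivs l q := by
  induction l with
  | nil => exact hq
  | cons j l ih =>
    rw [List.mem_cons, not_or] at hl
    rw [oneSubPderivs_cons]
    exact dvd_sub_pderiv_of_ne (Ne.symm hl.1) (ih hl.2)

lemma dvd_oneSubPderivs_of_sq_dvd {i : Fin m} {q : MvPolynomial (Fin (m + 1)) ℂ}
    (hq : X i.succ ^ 2 ∣ q) {l : List (Fin m)} (hl : l.Nodup) :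
    X i.succ ^ 1 ∣ oneSubPderivs l q := by
  induction l with
  | nil => exact (pow_dvd_pow _ one_le_two).trans hq
  | cons j l ih =>
    rw [List.nodup_cons] at hl
    rw [oneSubPderivs_cons]
    by_cases hji : j = i
    · subst hji
      obtain ⟨p, hp⟩ := dvd_oneSubPderivs_of_notMem hq hl.1
      rw [hp, pderiv_mul, pderiv_pow, pderiv_X_self]
      exact ⟨X j.succ * p - (2 * p + X j.succ * pderiv j.succ p), by push_cast; ring⟩
    · exact dvd_sub_pderiv_of_ne hji (ih hl.2)

lemma specializeZero_oneSubPderivs_eq_zero {i : Fin m} {q : MvPolynomial (Fin (m + 1)) ℂ}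
    (hq : X i.succ ^ 2 ∣ q) :
    specializeZero m (oneSubPderivs (List.finRange m) q) = 0 := by
  obtain ⟨p, hp⟩ := dvd_oneSubPderivs_of_sq_dvd hq (List.nodup_finRange m)
  rw [hp, map_mul, map_pow]
  simp [specializeZero]

lemma pencil_update (c : Fin m → ℂ) (A : Fin m → Matrix (Fin d) (Fin d) ℂ) (i : Fin m)
    (P : Matrix (Fin d) (Fin d) ℂ) :
    pencil c (Function.update A i P) =
      pencil c (Function.update A i 0) + (X i.succ - C (c i)) • P.map C := by
  have hsum : ∀ Q : Matrix (Fin d) (Fin d) ℂ,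
      ∑ k, (X k.succ - C (c k) : MvPolynomial (Fin (m + 1)) ℂ) •
          (Function.update A i Q k).map (C : ℂ →+* MvPolynomial (Fin (m + 1)) ℂ) =
        (X i.succ - C (c i) : MvPolynomial (Fin (m + 1)) ℂ) • Q.map C +
          ∑ k ∈ Finset.univ.erase i, (X k.succ - C (c k) : MvPolynomial (Fin (m + 1)) ℂ) •
            (A k).map C := fun Q => by
    rw [← Finset.add_sum_erase _ _ (Finset.mem_univ i), Function.update_self]
    congr 1
    refine Finset.sum_congr rfl fun k hk => ?_
    rw [Function.update_of_ne (Finset.ne_of_mem_erase hk)]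
  rw [pencil, pencil, hsum, hsum]
  simp only [Matrix.map_zero _ (map_zero _), smul_zero, zero_add]
  abel

lemma mixedCharPoly_update_eq (A : Fin m → Matrix (Fin d) (Fin d) ℂ) (i : Fin m)
    (P : Matrix (Fin d) (Fin d) ℂ) :
    mixedCharPoly (Function.update A i P) =
      mixedCharPoly (Function.update A i 0) +
        specializeZero m (oneSubPderivs (List.finRange m) (X i.succ *
          ∑ k, ((pencil 0 (Function.update A i 0)).updateRow k (P.map C k)).det)) := by
  have h := specializeZero_oneSubPderivs_eq_zero
    (sq_dvd_det_add_smul_sub (pencil 0 (Function.update A i 0)) (P.map C) (X i.succ))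
  rw [map_sub, map_sub, map_add, map_add, sub_eq_zero] at h
  rw [mixedCharPoly_eq, mixedCharPoly_eq, pencil_update, ← h]
  simp

lemma mixedCharPoly_update_affine (A : Fin m → Matrix (Fin d) (Fin d) ℂ) (i : Fin m)
    (P Q : Matrix (Fin d) (Fin d) ℂ) (t : ℝ) :
    mixedCharPoly (Function.update A i ((1 - t) • P + t • Q)) =
      polySegment (mixedCharPoly (Function.update A i P))
        (mixedCharPoly (Function.update A i Q)) t := by
  set N := pencil 0 (Function.update A i 0)
  have hrow : ∀ k, (N.updateRow k ((((1 - t) • P + t • Q).map C) k)).det =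
      C ((1 - t : ℝ) : ℂ) * (N.updateRow k (P.map C k)).det +
        C (t : ℂ) * (N.updateRow k (Q.map C k)).det := fun k => by
    rw [← Matrix.det_updateRow_smul, ← Matrix.det_updateRow_smul, ← Matrix.det_updateRow_add]
    congr 2
    ext1 j
    simp [Complex.real_smul]
  have hsum : X i.succ * ∑ k, (N.updateRow k ((((1 - t) • P + t • Q).map C) k)).det =
      ((1 - t : ℝ) : ℂ) • (X i.succ * ∑ k, (N.updateRow k (P.map C k)).det) +
        (t : ℂ) • (X i.succ * ∑ k, (N.updateRow k (Q.map C k)).det) := by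
    rw [Finset.sum_congr rfl fun k _ => hrow k, Finset.sum_add_distrib, ← Finset.mul_sum,
      ← Finset.mul_sum, smul_eq_C_mul, smul_eq_C_mul]
    ring
  rw [polySegment, mixedCharPoly_update_eq A i P, mixedCharPoly_update_eq A i Q,
    mixedCharPoly_update_eq A i (_ + _), hsum]
  simp only [map_add, map_smul, Polynomial.smul_eq_C_mul]
  have h1 : Polynomial.C ((1 - t : ℝ) : ℂ) = 1 - Polynomial.C (t : ℂ) := by simp
  rw [h1]
  ring

/-! ### The rank-one case -/

lemma pderiv_det_eq_zero {i : Fin (m + 1)}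
    {M : Matrix (Fin d) (Fin d) (MvPolynomial (Fin (m + 1)) ℂ)}
    (hM : ∀ a b, pderiv i (M a b) = 0) : pderiv i M.det = 0 := by
  rw [Matrix.det_apply', map_sum]
  refine Finset.sum_eq_zero fun σ _ => ?_
  have hprod : pderiv i (∏ a, M (σ a) a) = 0 :=
    Finset.prod_induction _ (fun p => pderiv i p = 0)
      (fun p q hp hq => by rw [pderiv_mul, hp, hq]; simp) (by simp) fun a _ => hM _ _
  rw [pderiv_mul, hprod]
  simp

lemma pderiv_pencil_update_zero (c : Fin m → ℂ) (A : Fin m → Matrix (Fin d) (Fin d) ℂ)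
    (i : Fin m) (a b : Fin d) :
    pderiv i.succ (pencil c (Function.update A i 0) a b) = 0 := by
  have hsum : (∑ k, (X k.succ - C (c k) : MvPolynomial (Fin (m + 1)) ℂ) •
      (Function.update A i 0 k).map (C : ℂ →+* MvPolynomial (Fin (m + 1)) ℂ)) a b =
      ∑ k, (X k.succ - C (c k) : MvPolynomial (Fin (m + 1)) ℂ) *
        C (Function.update A i 0 k a b) := by
    simp [Matrix.sum_apply]
  rw [pencil, Matrix.add_apply, hsum, map_add, map_sum, Matrix.smul_apply, smul_eq_mul,
    Finset.sum_eq_zero, add_zero, pderiv_mul, pderiv_X_of_ne (Fin.succ_ne_zero i).symm, zero_mul,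
    zero_add]
  · rw [Matrix.one_apply]
    split_ifs <;> simp
  · intro k _
    by_cases hk : k = i
    · subst hk; simp
    · rw [pderiv_mul, pderiv_C, map_sub, pderiv_C,
        pderiv_X_of_ne (by simpa using hk)]
      simp

lemma pencil_update_coeff (c : Fin m → ℂ) (A : Fin m → Matrix (Fin d) (Fin d) ℂ) (i : Fin m)
    (s : ℂ) : pencil (Function.update c i s) (Function.update A i 0) =
      pencil c (Function.update A i 0) := by
  rw [pencil, pencil]
  congr 1
  refine Finset.sum_congr rfl fun k _ => ?_
  by_cases hk : k = i
  · subst hk; simp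
  · simp [hk]

lemma sub_pderiv_det_pencil (c : Fin m → ℂ) (A : Fin m → Matrix (Fin d) (Fin d) ℂ) (i : Fin m)
    (hi : (A i).rank = 1) :
    (pencil c A).det - pderiv i.succ (pencil c A).det =
      (pencil (Function.update c i (c i + 1)) A).det := by
  obtain ⟨u, v, huv⟩ := exists_eq_vecMulVec_of_rank_eq_one hi
  have hmap : (A i).map (C : ℂ →+* MvPolynomial (Fin (m + 1)) ℂ) =
      Matrix.vecMulVec (fun a => C (u a)) (fun a => C (v a)) := by
    rw [huv]; ext1 a b; simp [Matrix.vecMulVec_apply]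
  have hA : Function.update A i (A i) = A := Function.update_eq_self i A
  have hdet : ∀ c' : Fin m → ℂ, (pencil c' A).det = (pencil c' (Function.update A i 0)).det +
      (X i.succ - C (c' i)) * ∑ k, ((pencil c' (Function.update A i 0)).updateRow k
        ((A i).map (C : ℂ →+* MvPolynomial (Fin (m + 1)) ℂ) k)).det := fun c' => by
    conv_lhs => rw [← hA, pencil_update]
    rw [hmap, det_add_smul_vecMulVec]
  have hsum : pderiv i.succ (∑ k, ((pencil c (Function.update A i 0)).updateRow k
      ((A i).map (C : ℂ →+* MvPolynomial (Fin (m + 1)) ℂ) k)).det) = 0 := by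
    rw [map_sum]
    refine Finset.sum_eq_zero fun k _ => pderiv_det_eq_zero fun a b => ?_
    by_cases ha : a = k
    · subst ha; simp
    · rw [Matrix.updateRow_ne ha, pderiv_pencil_update_zero]
  rw [hdet c, hdet (Function.update c i (c i + 1)), pencil_update_coeff, map_add, pderiv_mul,
    hsum, pderiv_det_eq_zero (pderiv_pencil_update_zero c A i), map_sub, pderiv_X_self, pderiv_C,
    Function.update_self, map_add, map_one]
  ring

lemma oneSubPderivs_det_pencil (A : Fin m → Matrix (Fin d) (Fin d) ℂ)
    (hA : ∀ i, (A i).rank = 1) {l : List (Fin m)} (hl : l.Nodup) :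
    oneSubPderivs l (pencil 0 A).det = (pencil (fun i => if i ∈ l then 1 else 0) A).det := by
  induction l with
  | nil => simp; rfl
  | cons i l ih =>
    rw [List.nodup_cons] at hl
    rw [oneSubPderivs_cons, ih hl.2, sub_pderiv_det_pencil _ _ _ (hA i)]
    congr 2
    funext k
    by_cases hk : k = i
    · subst hk; simp [hl.1]
    · simp [hk]

lemma mixedCharPoly_eq_charpoly (A : Fin m → Matrix (Fin d) (Fin d) ℂ)
    (hA : ∀ i, (A i).rank = 1) : mixedCharPoly A = (∑ i, A i).charpoly := by
  rw [mixedCharPoly_eq, oneSubPderivs_det_pencil A hA (List.nodup_finRange m), AlgHom.map_det,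
    Matrix.charpoly]
  congr 1
  ext1 a b
  simp only [List.mem_finRange, if_true, pencil, map_one, AlgHom.mapMatrix_apply, Matrix.map_apply,
    Matrix.add_apply, Matrix.sum_apply, Matrix.smul_apply, smul_eq_mul, map_add, map_sum, map_mul,
    map_sub, Matrix.charmatrix_apply, Matrix.one_apply, Matrix.diagonal_apply]
  simp only [specializeZero, aeval_X, aeval_C, Fin.cases_zero, Fin.cases_succ]
  split_ifs <;> simp [sub_eq_add_neg]

end MixedCharacteristic

section Stability

variable {d m : ℕ}

/-- `q` has no zeros with `z` in the open and all `z_i` in the closed upper (`σ = 1`) or lower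
(`σ = -1`) half-plane. -/
def HalfPlaneStable (σ : ℝ) (q : MvPolynomial (Fin (m + 1)) ℂ) : Prop :=
  ∀ x : Fin (m + 1) → ℂ, 0 < σ * (x 0).im → (∀ i : Fin m, 0 ≤ σ * (x i.succ).im) →
    eval x q ≠ 0

lemma eq_zero_or_mul_im_sum_inv_neg {σ : ℝ} {w : ℂ} (hw : 0 ≤ σ * w.im) (s : Multiset ℂ)
    (hs : ∀ z ∈ s, σ * z.im < 0) :
    s = 0 ∨ σ * ((s.map fun z => 1 / (w - z)).sum).im < 0 := by
  induction s using Multiset.induction_on with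
  | empty => exact Or.inl rfl
  | cons z s ih =>
    right
    have hz : σ * (1 / (w - z)).im < 0 := by
      have hlt : 0 < σ * (w - z).im := by
        rw [Complex.sub_im, mul_sub]
        linarith [hs z (Multiset.mem_cons_self z s)]
      have hne : w - z ≠ 0 := by
        rintro h0
        simp [h0] at hlt
      rw [one_div, Complex.inv_im, mul_div_assoc', mul_neg]
      exact div_neg_of_neg_of_pos (neg_neg_of_pos hlt) (Complex.normSq_pos.2 hne)
    rw [Multiset.map_cons, Multiset.sum_cons, Complex.add_im, mul_add]
    rcases ih fun y hy => hs y (Multiset.mem_cons_of_mem hy) with rfl | h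
    · simpa using hz
    · linarith

lemma eval_sub_derivative_ne_zero {σ : ℝ} {Q : Polynomial ℂ}
    (hQ : ∀ w : ℂ, 0 ≤ σ * w.im → Q.eval w ≠ 0) {w : ℂ} (hw : 0 ≤ σ * w.im) :
    Q.eval w - Q.derivative.eval w ≠ 0 := by
  intro h0
  have hsum := (IsAlgClosed.splits Q).eval_derivative_div_eval_of_ne_zero (hQ w hw)
  rw [← sub_eq_zero.1 h0, div_self (hQ w hw)] at hsum
  rcases eq_zero_or_mul_im_sum_inv_neg hw Q.roots fun z hz => by
      by_contra! hle
      exact hQ z hle (Polynomial.isRoot_of_mem_roots hz) with h | h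
  · simp [h] at hsum
  · rw [← hsum] at h
    simp at h

/-- The restriction of `q` to the line through `x` in the direction of the variable `i`. -/
noncomputable def lineRestrict (x : Fin (m + 1) → ℂ) (i : Fin (m + 1)) :
    MvPolynomial (Fin (m + 1)) ℂ →ₐ[ℂ] Polynomial ℂ :=
  aeval (Function.update (fun k => Polynomial.C (x k)) i Polynomial.X)

lemma eval_lineRestrict (x : Fin (m + 1) → ℂ) (i : Fin (m + 1)) (w : ℂ)
    (q : MvPolynomial (Fin (m + 1)) ℂ) :
    (lineRestrict x i q).eval w = eval (Function.update x i w) q := by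
  induction q using MvPolynomial.induction_on with
  | C a => simp [lineRestrict]
  | add p q hp hq => simp [hp, hq]
  | mul_X p k hp =>
    rw [map_mul, Polynomial.eval_mul, hp, map_mul, eval_X]
    congr 1
    by_cases hk : k = i
    · subst hk; simp [lineRestrict]
    · simp [lineRestrict, hk]

lemma derivative_lineRestrict (x : Fin (m + 1) → ℂ) (i : Fin (m + 1))
    (q : MvPolynomial (Fin (m + 1)) ℂ) :
    (lineRestrict x i q).derivative = lineRestrict x i (pderiv i q) := by
  induction q using MvPolynomial.induction_on with
  | C a => simp [lineRestrict]
  | add p q hp hq => simp [hp, hq]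
  | mul_X p k hp =>
    have hX : (lineRestrict x i (X k)).derivative = lineRestrict x i (pderiv i (X k)) := by
      by_cases hk : k = i
      · subst hk; simp [lineRestrict]
      · simp [lineRestrict, hk, pderiv_X_of_ne hk]
    rw [map_mul, Polynomial.derivative_mul, hp, hX, pderiv_mul, map_add, map_mul, map_mul]

lemma HalfPlaneStable.sub_pderiv {σ : ℝ} {q : MvPolynomial (Fin (m + 1)) ℂ}
    (hq : HalfPlaneStable σ q) (i : Fin m) :
    HalfPlaneStable σ (q - pderiv i.succ q) := by
  intro x h0 hx
  have hQ : ∀ w : ℂ, 0 ≤ σ * w.im → (lineRestrict x i.succ q).eval w ≠ 0 := fun w hw => by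
    rw [eval_lineRestrict]
    refine hq _ ?_ fun k => ?_
    · rwa [Function.update_of_ne (Fin.succ_ne_zero i).symm]
    · by_cases hk : k = i
      · subst hk; simpa using hw
      · rw [Function.update_of_ne (by simpa using hk)]
        exact hx k
  have h := eval_sub_derivative_ne_zero hQ (hx i)
  rwa [derivative_lineRestrict, eval_lineRestrict, eval_lineRestrict, Function.update_eq_self,
    ← map_sub] at h

lemma HalfPlaneStable.oneSubPderivs {σ : ℝ} {q : MvPolynomial (Fin (m + 1)) ℂ}
    (hq : HalfPlaneStable σ q) (l : List (Fin m)) : HalfPlaneStable σ (oneSubPderivs l q) := by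
  induction l with
  | nil => exact hq
  | cons i l ih =>
    rw [oneSubPderivs_cons]
    exact ih.sub_pderiv i

lemma halfPlaneStable_det_pencil (σ : ℝ) {A : Fin m → Matrix (Fin d) (Fin d) ℂ}
    (hA : ∀ i, (A i).PosSemidef) : HalfPlaneStable σ (pencil 0 A).det := by
  intro x h0 hx hdet
  have hmap : (eval x).mapMatrix (pencil 0 A) = x 0 • 1 + ∑ i : Fin m, x i.succ • A i := by
    ext1 a b
    simp [pencil, Matrix.sum_apply, Matrix.one_apply, apply_ite]
  rw [RingHom.map_det, hmap] at hdet
  obtain ⟨v, hv, hzero⟩ := Matrix.exists_mulVec_eq_zero_iff.2 hdet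
  have hform := congrArg (fun y => σ * (star v ⬝ᵥ y).im) hzero
  have hpos : 0 < star v ⬝ᵥ v := Matrix.dotProduct_star_self_pos_iff.2 hv
  have hnn : ∀ i, 0 ≤ star v ⬝ᵥ (A i).mulVec v := fun i => (hA i).dotProduct_mulVec_nonneg v
  simp only [Matrix.add_mulVec, Matrix.smul_mulVec, Matrix.one_mulVec, Matrix.sum_mulVec,
    dotProduct_add, dotProduct_smul, dotProduct_sum, smul_eq_mul, dotProduct_zero, Complex.add_im,
    Complex.im_sum, Complex.mul_im, Complex.zero_im, mul_zero] at hform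
  rw [Complex.pos_iff] at hpos
  simp only [Complex.nonneg_iff] at hnn
  simp only [← hpos.2, ← (hnn _).2, mul_zero, zero_add, mul_add, Finset.mul_sum] at hform
  have h1 : 0 < σ * ((x 0).im * (star v ⬝ᵥ v).re) := by
    rw [← mul_assoc]; exact mul_pos h0 hpos.1
  have h2 : 0 ≤ ∑ i : Fin m, σ * ((x i.succ).im * (star v ⬝ᵥ (A i).mulVec v).re) :=
    Finset.sum_nonneg fun i _ => by rw [← mul_assoc]; exact mul_nonneg (hx i) (hnn i).1
  linarith

lemma eval_specializeZero (z : ℂ) (q : MvPolynomial (Fin (m + 1)) ℂ) :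
    (specializeZero m q).eval z = eval (Fin.cases z fun _ => 0) q := by
  induction q using MvPolynomial.induction_on with
  | C a => simp [specializeZero]
  | add p q hp hq => simp [hp, hq]
  | mul_X p k hp =>
    rw [map_mul, Polynomial.eval_mul, hp, map_mul, eval_X]
    congr 1
    refine Fin.cases ?_ (fun k => ?_) k <;> simp [specializeZero]

lemma im_eq_zero_of_eval_mixedCharPoly_eq_zero {A : Fin m → Matrix (Fin d) (Fin d) ℂ}
    (hA : ∀ i, (A i).PosSemidef) {z : ℂ} (hz : (mixedCharPoly A).eval z = 0) : z.im = 0 := by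
  by_contra hne
  rw [mixedCharPoly_eq, eval_specializeZero] at hz
  refine (halfPlaneStable_det_pencil z.im hA).oneSubPderivs (List.finRange m) _ ?_ ?_ hz
  · exact mul_self_pos.2 hne
  · simp

end Stability

section Degree

variable {d m : ℕ}

lemma totalDegree_pderiv_le {τ R : Type*} [CommSemiring R] (i : τ) (q : MvPolynomial τ R) :
    (pderiv i q).totalDegree ≤ q.totalDegree - 1 := by
  conv_lhs => rw [q.as_sum, map_sum]
  refine totalDegree_finsetSum_le fun s hs => ?_
  rw [pderiv_monomial]
  by_cases hsi : s i = 0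
  · simp [hsi]
  refine (totalDegree_monomial_le _ _).trans ?_
  have hle : Finsupp.single i 1 ≤ s := by
    rw [Finsupp.single_le_iff]; exact Nat.one_le_iff_ne_zero.2 hsi
  have hdeg : (s - Finsupp.single i 1).degree + 1 = s.degree := by
    conv_rhs => rw [← tsub_add_cancel_of_le hle, map_add, Finsupp.degree_single]
  have hs' : s.degree ≤ q.totalDegree := le_totalDegree hs
  change (s - Finsupp.single i 1).degree ≤ _
  omega

lemma natDegree_specializeZero_le (q : MvPolynomial (Fin (m + 1)) ℂ) :
    (specializeZero m q).natDegree ≤ q.totalDegree := by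
  have h := aeval_natDegree_le (n := 1) q le_rfl
    (Fin.cases Polynomial.X fun _ : Fin m => (0 : Polynomial ℂ))
    (fun k => by refine Fin.cases ?_ (fun k => ?_) k <;> simp)
  rwa [mul_one] at h

lemma monic_specializeZero_oneSubPderivs {q : MvPolynomial (Fin (m + 1)) ℂ}
    (hdeg : q.totalDegree ≤ d) (hmonic : (specializeZero m q).Monic)
    (hnat : (specializeZero m q).natDegree = d) (l : List (Fin m)) :
    (oneSubPderivs l q).totalDegree ≤ d ∧ (specializeZero m (oneSubPderivs l q)).Monic ∧
      (specializeZero m (oneSubPderivs l q)).natDegree = d := by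
  induction l with
  | nil => exact ⟨hdeg, hmonic, hnat⟩
  | cons i l ih =>
    rw [oneSubPderivs_cons]
    set p := oneSubPderivs l q
    obtain ⟨h1, h2, h3⟩ := ih
    have hle := totalDegree_pderiv_le i.succ p
    refine ⟨(totalDegree_sub _ _).trans (max_le h1 (by omega)), ?_⟩
    have hlt : (specializeZero m (pderiv i.succ p)).degree < (specializeZero m p).degree := by
      rcases Nat.eq_zero_or_pos d with rfl | hd
      · have hp : pderiv i.succ p = 0 := by
          rw [totalDegree_eq_zero_iff_eq_C.1 (Nat.le_zero.1 h1), pderiv_C]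
        rw [hp, map_zero, Polynomial.degree_zero, bot_lt_iff_ne_bot, ne_eq,
          Polynomial.degree_eq_bot]
        exact h2.ne_zero
      · refine Polynomial.degree_lt_degree ?_
        have := natDegree_specializeZero_le (pderiv i.succ p)
        omega
    rw [map_sub]
    exact ⟨h2.sub_of_left hlt,
      (Polynomial.natDegree_eq_of_degree_eq (Polynomial.degree_sub_eq_left_of_degree_lt hlt)).trans h3⟩

lemma totalDegree_det_pencil_le (A : Fin m → Matrix (Fin d) (Fin d) ℂ) :
    (pencil 0 A).det.totalDegree ≤ d := by
  have hentry : ∀ a b, (pencil 0 A a b).totalDegree ≤ 1 := fun a b => by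
    have heq : pencil 0 A a b = X 0 * C ((1 : Matrix (Fin d) (Fin d) ℂ) a b) +
        ∑ i, X i.succ * C (A i a b) := by
      simp [pencil, Matrix.sum_apply, Matrix.one_apply, apply_ite]
    have hX : ∀ (k : Fin (m + 1)) (c : ℂ), (X k * C c : MvPolynomial _ ℂ).totalDegree ≤ 1 :=
      fun k c => (totalDegree_mul _ _).trans (by simp)
    rw [heq]
    exact (totalDegree_add _ _).trans
      (max_le (hX _ _) (totalDegree_finsetSum_le fun i _ => hX _ _))
  rw [Matrix.det_apply']
  refine totalDegree_finsetSum_le fun σ _ => (totalDegree_mul _ _).trans ?_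
  have hsign : (((Equiv.Perm.sign σ : ℤ) : MvPolynomial (Fin (m + 1)) ℂ)).totalDegree = 0 := by
    rw [← map_intCast (C : ℂ →+* MvPolynomial (Fin (m + 1)) ℂ), totalDegree_C]
  rw [hsign, zero_add]
  refine (totalDegree_finsetProd _ _).trans ((Finset.sum_le_sum fun a _ => hentry _ _).trans ?_)
  simp

lemma specializeZero_det_pencil (A : Fin m → Matrix (Fin d) (Fin d) ℂ) :
    specializeZero m (pencil 0 A).det = Polynomial.X ^ d := by
  have hmap : (specializeZero m).mapMatrix (pencil 0 A) = (Polynomial.X : Polynomial ℂ) • 1 := by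
    ext1 a b
    by_cases hab : a = b <;>
      simp [pencil, specializeZero, Matrix.sum_apply, hab]
  rw [AlgHom.map_det, hmap, Matrix.det_smul]
  simp

lemma monicRealRooted_mixedCharPoly {A : Fin m → Matrix (Fin d) (Fin d) ℂ}
    (hA : ∀ i, (A i).PosSemidef) : MonicRealRooted d (mixedCharPoly A) := by
  have h := monic_specializeZero_oneSubPderivs (totalDegree_det_pencil_le A)
    (by rw [specializeZero_det_pencil]; exact Polynomial.monic_X_pow d)
    (by rw [specializeZero_det_pencil, Polynomial.natDegree_X_pow]) (List.finRange m)
  rw [← mixedCharPoly_eq] at h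
  exact ⟨h.2.1, h.2.2, fun z hz => im_eq_zero_of_eval_mixedCharPoly_eq_zero hA hz⟩

end Degree

section Averaging

variable {d m : ℕ}

/-- Replacing one matrix by a convex combination of positive semidefinite matrices `B ω`, the
`k`-th largest root of the mixed characteristic polynomial lies in every order-connected set
containing the roots obtained from the `B ω`. -/
lemma rhoC_mixedCharPoly_update_sum_mem {Ω : Type*} [Fintype Ω] {pr : Ω → ℝ}
    (hpr : ∀ ω, 0 ≤ pr ω) (hsum : ∑ ω, pr ω = 1) {A : Fin m → Matrix (Fin d) (Fin d) ℂ}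
    (hA : ∀ i, (A i).PosSemidef) (i : Fin m) {B : Ω → Matrix (Fin d) (Fin d) ℂ}
    (hB : ∀ ω, (B ω).PosSemidef) (k : Fin d) {S : Set ℝ} (hS : S.OrdConnected)
    (hmem : ∀ ω, 0 < pr ω → rhoC (mixedCharPoly (Function.update A i (B ω))) (k + 1) ∈ S) :
    rhoC (mixedCharPoly (Function.update A i (∑ ω, (pr ω : ℂ) • B ω))) (k + 1) ∈ S := by
  have hpsd : ∀ P : Matrix (Fin d) (Fin d) ℂ, P.PosSemidef →
      ∀ l, (Function.update A i P l).PosSemidef := fun P hP l => by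
    by_cases hl : l = i
    · subst hl; simpa using hP
    · simpa [hl] using hA l
  have hcomb : ∀ {P Q : Matrix (Fin d) (Fin d) ℂ}, P.PosSemidef → Q.PosSemidef →
      ∀ t ∈ Set.Icc (0 : ℝ) 1, ((1 - t) • P + t • Q).PosSemidef := fun hP hQ t ht =>
    (hP.smul (sub_nonneg.2 ht.2)).add (hQ.smul ht.1)
  have hconv : Convex ℝ {P : Matrix (Fin d) (Fin d) ℂ | P.PosSemidef ∧
      rhoC (mixedCharPoly (Function.update A i P)) (k + 1) ∈ S} := by
    rintro P ⟨hP, hPS⟩ Q ⟨hQ, hQS⟩ a b ha hb hab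
    obtain rfl : a = 1 - b := by linarith
    have hb' : b ∈ Set.Icc (0 : ℝ) 1 := ⟨hb, by linarith⟩
    refine ⟨hcomb hP hQ b hb', ?_⟩
    rw [mixedCharPoly_update_affine]
    refine hS.uIcc_subset hPS hQS (rhoC_polySegment_between (fun t ht => ?_) k hb')
    rw [← mixedCharPoly_update_affine]
    exact monicRealRooted_mixedCharPoly (hpsd _ (hcomb hP hQ t ht))
  have hin := hconv.sum_mem (t := Finset.univ.filter fun ω => 0 < pr ω) (w := pr) (z := B)
    (fun ω _ => hpr ω)
    ((Finset.sum_filter_of_ne fun ω _ hne => (hpr ω).lt_of_ne hne.symm).trans hsum)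
    (fun ω hω => ⟨hB ω, hmem ω (Finset.mem_filter.1 hω).2⟩)
  rw [Finset.sum_filter_of_ne] at hin
  · simpa using hin.2
  · exact fun ω _ hne => (hpr ω).lt_of_ne fun h0 => hne (by rw [← h0, zero_smul])

lemma posSemidef_sum_ofReal_smul {Ω : Type*} [Fintype Ω] {pr : Ω → ℝ} (hpr : ∀ ω, 0 ≤ pr ω)
    {B : Ω → Matrix (Fin d) (Fin d) ℂ} (hB : ∀ ω, (B ω).PosSemidef) :
    (∑ ω, (pr ω : ℂ) • B ω).PosSemidef :=
  Matrix.posSemidef_sum _ fun ω _ => (hB ω).smul (by exact_mod_cast hpr ω)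

/-- Points of positive probability can be chosen independently for each matrix, so that the
`k`-th largest root stays in a given set `S` with order-connected complement. -/
lemma exists_choice_rhoC_charpoly_mem {Ω : Type*} [Fintype Ω] {pr : Ω → ℝ}
    (hpr : ∀ ω, 0 ≤ pr ω) (hsum : ∑ ω, pr ω = 1)
    {A : Fin m → Ω → Matrix (Fin d) (Fin d) ℂ} (hpsd : ∀ i ω, (A i ω).PosSemidef)
    (hrank : ∀ i ω, (A i ω).rank = 1) (k : Fin d) {S : Set ℝ} (hS : Sᶜ.OrdConnected)
    (hmem : rhoC (mixedCharPoly fun i => ∑ ω, (pr ω : ℂ) • A i ω) (k + 1) ∈ S) :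
    ∃ w : Fin m → Ω, (∀ i, 0 < pr (w i)) ∧ rhoC (∑ i, A i (w i)).charpoly (k + 1) ∈ S := by
  obtain ⟨ω₀, hω₀⟩ : ∃ ω, 0 < pr ω := by
    by_contra! hle
    linarith [Finset.sum_nonpos fun ω (_ : ω ∈ Finset.univ) => hle ω]
  have hstep : ∀ s : Finset (Fin m), ∃ w : Fin m → Ω, (∀ i, 0 < pr (w i)) ∧
      rhoC (mixedCharPoly fun i => if i ∈ s then A i (w i) else ∑ ω, (pr ω : ℂ) • A i ω)
        (k + 1) ∈ S := by
    intro s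
    induction s using Finset.induction_on with
    | empty => exact ⟨fun _ => ω₀, fun _ => hω₀, by simpa using hmem⟩
    | insert i s his ih =>
      obtain ⟨w, hw, hwS⟩ := ih
      set D : Fin m → Matrix (Fin d) (Fin d) ℂ :=
        fun i => if i ∈ s then A i (w i) else ∑ ω, (pr ω : ℂ) • A i ω with hD
      have hDpsd : ∀ l, (D l).PosSemidef := fun l => by
        simp only [hD]
        split_ifs
        · exact hpsd _ _
        · exact posSemidef_sum_ofReal_smul hpr (hpsd l)
      have hDi : Function.update D i (∑ ω, (pr ω : ℂ) • A i ω) = D :=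
        Function.update_eq_self_iff.2 (by simp [hD, his])
      obtain ⟨ω, hω, hωS⟩ : ∃ ω, 0 < pr ω ∧
          rhoC (mixedCharPoly (Function.update D i (A i ω))) (k + 1) ∈ S := by
        by_contra! hcon
        have := rhoC_mixedCharPoly_update_sum_mem hpr hsum hDpsd i (hpsd i) k hS hcon
        rw [hDi] at this
        exact this hwS
      refine ⟨Function.update w i ω, fun l => ?_, ?_⟩
      · by_cases hl : l = i
        · subst hl; simpa using hω
        · simpa [hl] using hw l
      · convert hωS using 3
        funext l
        by_cases hl : l = i
        · subst hl; simp
        · simp [hD, hl]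
  obtain ⟨w, hw, hwS⟩ := hstep Finset.univ
  refine ⟨w, hw, ?_⟩
  simpa only [Finset.mem_univ, if_true,
    mixedCharPoly_eq_charpoly (fun i => A i (w i)) fun i => hrank i _] using hwS

lemma IndepMatrices.exists_forall_eq {Ω : Type*} [Fintype Ω] {pr : Ω → ℝ}
    (hpr : ∀ ω, 0 ≤ pr ω) {A : Fin m → Ω → Matrix (Fin d) (Fin d) ℂ}
    (h : IndepMatrices pr A) {w : Fin m → Ω} (hw : ∀ i, 0 < pr (w i)) :
    ∃ ω, 0 < pr ω ∧ ∀ i, A i ω = A i (w i) := by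
  have hpos : 0 < ∑ ω, if ∀ i, A i ω = A i (w i) then pr ω else 0 := by
    rw [h fun i => A i (w i)]
    refine Finset.prod_pos fun i _ => Finset.sum_pos' (fun ω _ => ?_) ⟨w i, Finset.mem_univ _, ?_⟩
    · split_ifs
      · exact hpr ω
      · exact le_rfl
    · simpa using hw i
  by_contra! hcon
  refine hpos.not_ge (Finset.sum_nonpos fun ω _ => ?_)
  split_ifs with hω
  · by_contra! hlt
    obtain ⟨i, hi⟩ := hcon ω hlt
    exact hi (hω i)
  · exact le_rfl

end Averaging

/-- For independent rank-one positive semidefinite random matrices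
`A₁(ω), …, A_m(ω)` on a finite probability space, with `A = A₁ + ⋯ + A_m`, for every
`j = 1, …, d` the `j`-th largest root of `μ[E(A₁), …, E(A_m)]` lies between the minimal
and the maximal value of the `j`-th largest eigenvalue of `A(ω)` over the points `ω` of
positive probability. -/
theorem rho_mixedCharPoly_between (d m : ℕ) (Ω : Type*) [Fintype Ω]
    (pr : Ω → ℝ) (hpr : ∀ ω, 0 ≤ pr ω) (hsum : ∑ ω, pr ω = 1)
    (A : Fin m → Ω → Matrix (Fin d) (Fin d) ℂ)
    (hpsd : ∀ i ω, (A i ω).PosSemidef)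
    (hrank : ∀ i ω, (A i ω).rank = 1)
    (hindep : IndepMatrices pr A) :
    ∀ j : ℕ, 1 ≤ j → j ≤ d →
      (∃ ω, 0 < pr ω ∧
        rhoC (Matrix.charpoly (∑ i, A i ω)) j
          ≤ rhoC (mixedCharPoly (fun i => ∑ ω', (pr ω' : ℂ) • A i ω')) j) ∧
      (∃ ω, 0 < pr ω ∧
        rhoC (mixedCharPoly (fun i => ∑ ω', (pr ω' : ℂ) • A i ω')) j
          ≤ rhoC (Matrix.charpoly (∑ i, A i ω)) j) := by
  intro j hj1 hjd
  obtain ⟨k, rfl⟩ : ∃ k : Fin d, j = k + 1 := ⟨⟨j - 1, by omega⟩, by simp; omega⟩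
  set μ := rhoC (mixedCharPoly fun i => ∑ ω', (pr ω' : ℂ) • A i ω') (k + 1)
  have key : ∀ S : Set ℝ, Sᶜ.OrdConnected → μ ∈ S →
      ∃ ω, 0 < pr ω ∧ rhoC (Matrix.charpoly (∑ i, A i ω)) (k + 1) ∈ S := by
    intro S hS hμ
    obtain ⟨w, hw, hwS⟩ := exists_choice_rhoC_charpoly_mem hpr hsum hpsd hrank k hS hμ
    obtain ⟨ω, hω, hωw⟩ := hindep.exists_forall_eq hpr hw
    refine ⟨ω, hω, ?_⟩
    simpa only [hωw] using hwS
  exact ⟨key (Set.Iic μ) (by rw [Set.compl_Iic]; exact Set.ordConnected_Ioi) Set.self_mem_Iic,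
    key (Set.Ici μ) (by rw [Set.compl_Ici]; exact Set.ordConnected_Iio) Set.self_mem_Ici⟩
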